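/- arXiv:2506.22889 — 2 statements merged into one kernel-verified Lean document; each statement's English description precedes it below -/
import Mathlib

section
/- The separating Noether number of the cyclic group C_p over ℚ equals 3 for every prime p ≥ 3, and equals 2 for p = 2. That is, for every finite dimensional ℚ-representation of C_p, invariants of degree at most 3 (resp. 2 when p = 2) separate the orbits, and this degree bound is sharp. -/
open MvPolynomial

/-- `SepByDeg p n d ρ` : the polynomial invariants of degree at most `d` of the
`n`-dimensional rational representation `ρ` of the cyclic group `C_p` separate its orbits. -/
def SepByDeg (p n d : ℕ) (ρ : Multiplicative (ZMod p) →* Matrix (Fin n) (Fin n) ℚ) : Prop :=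
  ∀ v w : Fin n → ℚ, (¬ ∃ g, (ρ g).mulVec v = w) →
    ∃ f : MvPolynomial (Fin n) ℚ,
      (∀ g (u : Fin n → ℚ), eval ((ρ g).mulVec u) f = eval u f) ∧
      f.totalDegree ≤ d ∧ eval v f ≠ eval w f

section Moments

variable {p n : ℕ} [NeZero p]

/-- The coordinates of the points of the orbit of `v`, as functions on `ZMod p`. -/
def orbitCoord (ρ : Multiplicative (ZMod p) →* Matrix (Fin n) (Fin n) ℚ) (v : Fin n → ℚ)
    (i : Fin n) (k : ZMod p) : ℚ :=
  (ρ (Multiplicative.ofAdd k)).mulVec v i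

/-- If the invariants of degree at most `d` do not separate `v` and `w`, then all orbit sums of
products of at most `d` coordinates agree. -/
theorem sum_prod_orbitCoord_eq {d : ℕ} {ρ : Multiplicative (ZMod p) →* Matrix (Fin n) (Fin n) ℚ}
    {v w : Fin n → ℚ}
    (h : ∀ f : MvPolynomial (Fin n) ℚ,
      (∀ g (u : Fin n → ℚ), eval ((ρ g).mulVec u) f = eval u f) → f.totalDegree ≤ d →
        eval v f = eval w f)
    {m : ℕ} (hm : m ≤ d) (i : Fin m → Fin n) (κ : Fin m → ZMod p) :
    ∑ g, ∏ s, orbitCoord ρ v (i s) (κ s + g) = ∑ g, ∏ s, orbitCoord ρ w (i s) (κ s + g) := by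
  let F : MvPolynomial (Fin n) ℚ :=
    ∑ g : ZMod p, ∏ s, ∑ j, C (ρ (Multiplicative.ofAdd (κ s + g)) (i s) j) * X j
  have hF : ∀ u, eval u F = ∑ g, ∏ s, orbitCoord ρ u (i s) (κ s + g) := by
    intro u
    simp [F, map_sum, map_prod, orbitCoord, Matrix.mulVec, dotProduct]
  rw [← hF, ← hF]
  refine h F ?_ ?_
  · intro g u
    rw [hF, hF, ← Equiv.sum_comp (Equiv.addRight (Multiplicative.toAdd g))
      (fun x => ∏ s, orbitCoord ρ u (i s) (κ s + x))]
    refine Finset.sum_congr rfl fun x _ => Finset.prod_congr rfl fun s _ => ?_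
    simp only [orbitCoord, Matrix.mulVec_mulVec, ← map_mul, Equiv.coe_addRight, ← add_assoc]
    rfl
  · refine totalDegree_finsetSum_le fun g _ => ?_
    refine (totalDegree_finsetProd _ _).trans (le_trans ?_ hm)
    calc _ ≤ ∑ _s : Fin m, 1 := Finset.sum_le_sum fun s _ => totalDegree_finsetSum_le fun j _ => ?_
      _ = m := by simp
    exact (totalDegree_mul _ _).trans (by simp)

end Moments

section RegularRepresentation

variable {p : ℕ} [NeZero p]

/-- The regular representation of the cyclic group `C_p` over `ℚ`. -/
def regularRep (p : ℕ) [NeZero p] : Multiplicative (ZMod p) →* Matrix (Fin p) (Fin p) ℚ where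
  toFun g := Matrix.of fun i j =>
    if j = (ZMod.finEquiv p).symm (ZMod.finEquiv p i + Multiplicative.toAdd g) then 1 else 0
  map_one' := by
    ext i j
    simp [Matrix.one_apply, eq_comm]
  map_mul' g h := by
    ext i j
    simp only [Matrix.of_apply, Matrix.mul_apply, ite_mul, one_mul, zero_mul, Finset.sum_ite_eq',
      Finset.mem_univ, if_true, RingEquiv.apply_symm_apply, toAdd_mul, add_assoc]

theorem regularRep_mulVec (g : Multiplicative (ZMod p)) (a : ZMod p → ℚ) :
    (regularRep p g).mulVec (fun i => a (ZMod.finEquiv p i)) =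
      fun i => a (ZMod.finEquiv p i + Multiplicative.toAdd g) := by
  ext i
  simp [regularRep, Matrix.mulVec, dotProduct]

theorem isUnit_regularRep (g : Multiplicative (ZMod p)) : IsUnit (regularRep p g) :=
  (Group.isUnit g).map _

/-- Functions on `ZMod p` with the same moments up to degree `d` are not separated by the
invariants of the regular representation of degree at most `d`. -/
theorem not_sepByDeg_regularRep {d : ℕ} {a b : ZMod p → ℚ} (hab : ∀ h, ∃ k, a (k + h) ≠ b k)
    (hm : ∀ M : Multiset (ZMod p), M.card ≤ d →
      ∑ g, (M.map fun t => a (t + g)).prod = ∑ g, (M.map fun t => b (t + g)).prod) :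
    ¬ SepByDeg p p d (regularRep p) := by
  intro H
  obtain ⟨f, hinv, hdeg, hne⟩ :=
    H (fun i => a (ZMod.finEquiv p i)) (fun i => b (ZMod.finEquiv p i)) (by
      rintro ⟨g, hg⟩
      obtain ⟨k, hk⟩ := hab (Multiplicative.toAdd g)
      rw [regularRep_mulVec] at hg
      simpa [hk] using congrFun hg ((ZMod.finEquiv p).symm k))
  have key : ∀ c : ZMod p → ℚ, (p : ℚ) * eval (fun i => c (ZMod.finEquiv p i)) f =
      ∑ s ∈ f.support, f.coeff s *
        ∑ g, (((s.toMultiset).map (ZMod.finEquiv p)).map fun t => c (t + g)).prod := by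
    intro c
    have h1 : (p : ℚ) * eval (fun i => c (ZMod.finEquiv p i)) f =
        ∑ g : ZMod p, eval (fun i => c (ZMod.finEquiv p i + g)) f := by
      have : ∀ g : ZMod p, eval (fun i => c (ZMod.finEquiv p i + g)) f =
          eval (fun i => c (ZMod.finEquiv p i)) f := fun g => by
        rw [← hinv (Multiplicative.ofAdd g) (fun i => c (ZMod.finEquiv p i)), regularRep_mulVec]
        rfl
      simp [this, ZMod.card]
    rw [h1]
    simp_rw [eval_eq, Finset.mul_sum]
    rw [Finset.sum_comm]
    refine Finset.sum_congr rfl fun s _ => Finset.sum_congr rfl fun g _ => ?_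
    rw [Multiset.map_map, Finsupp.toMultiset_map, Finsupp.prod_toMultiset,
      Finsupp.prod_mapDomain_index (by simp) (by intros; rw [pow_add])]
    rfl
  apply hne
  have hp0 : (p : ℚ) ≠ 0 := NeZero.ne _
  apply mul_left_cancel₀ hp0
  rw [key, key]
  refine Finset.sum_congr rfl fun s hs => ?_
  rw [hm]
  rw [Multiset.card_map, Finsupp.card_toMultiset]
  exact (le_totalDegree hs).trans hdeg

theorem not_sepByDeg_two (hp : 3 ≤ p) : ¬ SepByDeg p p 2 (regularRep p) := by
  have : Fact (2 < p) := ⟨hp⟩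
  have : Fact (1 < p) := ⟨by omega⟩
  let a : ZMod p → ℚ := fun k => if k = 0 then 1 else if k = 1 then 2 else 0
  refine not_sepByDeg_regularRep (a := a) (b := fun k => a (-k)) ?_ ?_
  · intro h
    by_contra! H
    have h0 : h = 0 := by
      have := H 0
      simp only [a, zero_add, neg_zero] at this
      by_contra hh
      by_cases h1 : h = 1 <;> simp [hh, h1] at this
    have h1 := H (-1)
    simp [a, h0, ZMod.neg_one_ne_one] at h1
  · intro M hM
    interval_cases hc : M.card
    · rw [Multiset.card_eq_zero] at hc
      simp [hc]
    · obtain ⟨x, rfl⟩ := Multiset.card_eq_one.1 hc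
      simp only [Multiset.map_singleton, Multiset.prod_singleton]
      exact Fintype.sum_equiv (Equiv.subLeft (-(x + x))) _ _ fun g => by
        simp only [Equiv.subLeft_apply]
        congr 1
        ring
    · obtain ⟨x, y, rfl⟩ := Multiset.card_eq_two.1 hc
      simp only [Multiset.insert_eq_cons, Multiset.map_cons, Multiset.map_singleton,
        Multiset.prod_cons, Multiset.prod_singleton]
      exact Fintype.sum_equiv (Equiv.subLeft (-(x + y))) _ _ fun g => by
        simp only [Equiv.subLeft_apply]
        rw [mul_comm]
        congr 2 <;> ring

theorem not_sepByDeg_one : ¬ SepByDeg 2 2 1 (regularRep 2) := by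
  refine not_sepByDeg_regularRep (a := fun k => if k = 0 then 2 else 0) (b := fun _ => 1) ?_ ?_
  · intro h
    refine ⟨0, ?_⟩
    split_ifs <;> norm_num
  · intro M hM
    interval_cases hc : M.card
    · rw [Multiset.card_eq_zero] at hc
      simp [hc]
    · obtain ⟨x, rfl⟩ := Multiset.card_eq_one.1 hc
      simp only [Multiset.map_singleton, Multiset.prod_singleton]
      refine (Equiv.sum_comp (Equiv.addLeft x)
        (fun k : ZMod 2 => if k = 0 then (2 : ℚ) else 0)).trans ?_
      simp [ZMod.card]

end RegularRepresentation

section Fourier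

theorem map_sum_eq_prod {A M ι : Type*} [AddCommMonoid A] [CommMonoid M] (χ : AddChar A M)
    (s : Finset ι) (f : ι → A) : χ (∑ i ∈ s, f i) = ∏ i ∈ s, χ (f i) := by
  classical
  induction s using Finset.induction_on with
  | empty => simp
  | insert i s hi ih => simp [hi, ih, AddChar.map_add_eq_mul]

variable {p : ℕ} [Fact p.Prime] {L : Type*} [Field L] [Algebra ℚ L]

/-- The Fourier transform of `a` with respect to the additive character `χ`, at frequency `t`. -/
def fourierSum (χ : AddChar (ZMod p) L) (t : ZMod p) (a : ZMod p → ℚ) : L :=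
  ∑ k, algebraMap ℚ L (a k) * χ (t * k)

theorem fourierSum_shift (χ : AddChar (ZMod p) L) (t r : ZMod p) (a : ZMod p → ℚ) :
    fourierSum χ t (fun k => a (k + r)) = χ (-(t * r)) * fourierSum χ t a := by
  rw [fourierSum, fourierSum, Finset.mul_sum]
  refine Fintype.sum_equiv (Equiv.addRight r) _ _ fun k => ?_
  rw [mul_left_comm, ← AddChar.map_add_eq_mul, Equiv.coe_addRight]
  congr 2
  ring

theorem eq_of_fourierSum_eq {χ : AddChar (ZMod p) L} (hχ : χ.IsPrimitive) {a b : ZMod p → ℚ}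
    (h : ∀ t, fourierSum χ t a = fourierSum χ t b) : a = b := by
  have inv : ∀ (c : ZMod p → ℚ) (j : ZMod p),
      ∑ t, χ (t * -j) * fourierSum χ t c = algebraMap ℚ L (c j) * p := by
    intro c j
    simp_rw [fourierSum, Finset.mul_sum]
    rw [Finset.sum_comm]
    have : ∀ k, ∑ t, χ (t * -j) * (algebraMap ℚ L (c k) * χ (t * k)) =
        algebraMap ℚ L (c k) * if k = j then (p : L) else 0 := by
      intro k
      have h2 := AddChar.sum_mulShift (k - j) hχ
      rw [ZMod.card] at h2
      simp only [sub_eq_zero] at h2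
      rw [Nat.cast_ite, Nat.cast_zero] at h2
      rw [← h2, Finset.mul_sum]
      refine Finset.sum_congr rfl fun t _ => ?_
      rw [mul_left_comm, ← AddChar.map_add_eq_mul]
      congr 2
      ring
    simp only [this, mul_ite, mul_zero, Finset.sum_ite_eq', Finset.mem_univ, if_true]
  have hL : CharZero L := algebraRat.charZero L
  have hp0 : (p : L) ≠ 0 := Nat.cast_ne_zero.2 (Fact.out : p.Prime).ne_zero
  funext j
  apply (algebraMap ℚ L).injective
  apply mul_right_cancel₀ hp0
  rw [← inv, ← inv]
  simp [h]

/-- Products of Fourier coefficients whose frequencies sum to zero are determined by the moments. -/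
theorem prod_fourierSum_eq (χ : AddChar (ZMod p) L) {m : ℕ} (a b : Fin m → ZMod p → ℚ)
    (h : ∀ κ : Fin m → ZMod p, ∑ g, ∏ s, a s (κ s + g) = ∑ g, ∏ s, b s (κ s + g))
    (t : Fin m → ZMod p) (ht : ∑ s, t s = 0) :
    ∏ s, fourierSum χ (t s) (a s) = ∏ s, fourierSum χ (t s) (b s) := by
  have key : ∀ c : Fin m → ZMod p → ℚ, (p : L) * ∏ s, fourierSum χ (t s) (c s) =
      ∑ κ : Fin m → ZMod p, algebraMap ℚ L (∑ g, ∏ s, c s (κ s + g)) * ∏ s, χ (t s * κ s) := by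
    intro c
    have expand : ∏ s, fourierSum χ (t s) (c s) =
        ∑ κ : Fin m → ZMod p, ∏ s, (algebraMap ℚ L (c s (κ s)) * χ (t s * κ s)) := by
      simp_rw [fourierSum]
      rw [Finset.prod_univ_sum, Fintype.piFinset_univ]
    have shift : ∀ g : ZMod p, ∏ s, fourierSum χ (t s) (c s) =
        ∑ κ : Fin m → ZMod p, algebraMap ℚ L (∏ s, c s (κ s + g)) * ∏ s, χ (t s * κ s) := by
      intro g
      rw [expand, ← Equiv.sum_comp (Equiv.addRight fun _ : Fin m => g)]
      refine Finset.sum_congr rfl fun κ _ => ?_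
      have : ∏ s, χ (t s * g) = 1 := by
        rw [← map_sum_eq_prod, ← Finset.sum_mul, ht, zero_mul, AddChar.map_zero_eq_one]
      simp only [Equiv.coe_addRight, Pi.add_apply, mul_add, AddChar.map_add_eq_mul,
        Finset.prod_mul_distrib, map_prod, this, mul_one]
    have : (p : L) * ∏ s, fourierSum χ (t s) (c s) =
        ∑ _g : ZMod p, ∏ s, fourierSum χ (t s) (c s) := by simp [ZMod.card]
    rw [this, Finset.sum_congr rfl fun g _ => shift g, Finset.sum_comm]
    simp_rw [map_sum, Finset.sum_mul]
  have hL : CharZero L := algebraRat.charZero L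
  have hp0 : (p : L) ≠ 0 := Nat.cast_ne_zero.2 (Fact.out : p.Prime).ne_zero
  apply mul_left_cancel₀ hp0
  rw [key, key]
  simp [h]

theorem map_fourierSum {χ : AddChar (ZMod p) L} {σ : L ≃ₐ[ℚ] L} {t : ZMod p}
    (hσ : ∀ k, σ (χ k) = χ (t * k)) (a : ZMod p → ℚ) :
    σ (fourierSum χ 1 a) = fourierSum χ t a := by
  simp [fourierSum, map_sum, hσ]

end Fourier

section Cyclotomic

variable {p : ℕ} [Fact p.Prime]

instance isCyclotomicExtension_cyclotomicField (n : ℕ) [NeZero n] :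
    IsCyclotomicExtension {n} ℚ (CyclotomicField n ℚ) := by
  convert CyclotomicField.isCyclotomicExtension n ℚ
  · rfl
  · exact Subsingleton.elim _ _

/-- The standard additive character of `ZMod p` with values in the `p`-th cyclotomic field. -/
noncomputable def cyclotomicChar (p : ℕ) [Fact p.Prime] :
    AddChar (ZMod p) (CyclotomicField p ℚ) :=
  AddChar.zmodChar p (IsCyclotomicExtension.zeta_spec p ℚ (CyclotomicField p ℚ)).pow_eq_one

theorem isPrimitive_cyclotomicChar : (cyclotomicChar p).IsPrimitive :=
  AddChar.zmodChar_primitive_of_primitive_root p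
    (IsCyclotomicExtension.zeta_spec p ℚ (CyclotomicField p ℚ))

theorem exists_algEquiv_cyclotomicChar {t : ZMod p} (ht : t ≠ 0) :
    ∃ σ : CyclotomicField p ℚ ≃ₐ[ℚ] CyclotomicField p ℚ,
      ∀ k, σ (cyclotomicChar p k) = cyclotomicChar p (t * k) := by
  have hp : p.Prime := Fact.out
  have hζ := IsCyclotomicExtension.zeta_spec p ℚ (CyclotomicField p ℚ)
  have hμ := hζ.pow_of_coprime t.val
    ((ZMod.val_coe_unit_coprime (Units.mk0 t ht)))
  refine ⟨IsCyclotomicExtension.fromZetaAut hμ (Polynomial.cyclotomic.irreducible_rat hp.pos),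
    fun k => ?_⟩
  have : t * k = ((t.val * k.val : ℕ) : ZMod p) := by simp
  rw [this, cyclotomicChar, AddChar.zmodChar_apply', AddChar.zmodChar_apply, map_pow,
    IsCyclotomicExtension.fromZetaAut_spec, pow_mul]

/-- A solution `u` of `u ^ 2 * σ u = 1`, with `σ` the automorphism raising `p`-th roots of unity
to the power `-2`, is a `p`-th root of unity. -/
theorem exists_eq_cyclotomicChar (hp : 3 ≤ p)
    {σ : CyclotomicField p ℚ ≃ₐ[ℚ] CyclotomicField p ℚ}
    (hσ : ∀ k, σ (cyclotomicChar p k) = cyclotomicChar p (-2 * k))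
    {u : CyclotomicField p ℚ} (hu : u * u * σ u = 1) : ∃ r, u = cyclotomicChar p r := by
  have hpp : p.Prime := Fact.out
  have hu0 : u ≠ 0 := by
    rintro rfl
    simp at hu
  have hσu : σ u = u ^ (-2 : ℤ) := by
    rw [zpow_neg]
    refine eq_inv_of_mul_eq_one_right ?_
    rw [← hu, zpow_ofNat, sq]
  have iter : ∀ m : ℕ, (σ ^ m) u = u ^ ((-2 : ℤ) ^ m) := by
    intro m
    induction m with
    | zero => simp
    | succ m ih => rw [pow_succ', AlgEquiv.mul_apply, ih, map_zpow₀, hσu, ← zpow_mul, pow_succ']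
  have hord : 0 < orderOf σ := orderOf_pos σ
  have hfin : IsOfFinOrder u := by
    have h := iter (orderOf σ)
    rw [pow_orderOf_eq_one, AlgEquiv.one_apply] at h
    have h1 : u ^ ((-2 : ℤ) ^ orderOf σ - 1) = 1 := by
      rw [zpow_sub_one₀ hu0, ← h, mul_inv_cancel₀ hu0]
    have hodd : (-2 : ℤ) ^ orderOf σ - 1 ≠ 0 := by
      obtain ⟨m, hm⟩ := Nat.exists_eq_succ_of_ne_zero hord.ne'
      rw [hm, Nat.succ_eq_add_one, pow_succ]
      omega
    rw [isOfFinOrder_iff_pow_eq_one]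
    refine ⟨((-2 : ℤ) ^ orderOf σ - 1).natAbs, Int.natAbs_pos.2 hodd, ?_⟩
    rcases Int.natAbs_eq ((-2 : ℤ) ^ orderOf σ - 1) with h2 | h2
    · rw [h2, zpow_natCast] at h1
      exact h1
    · rw [h2, zpow_neg, zpow_natCast, inv_eq_one] at h1
      exact h1
  obtain ⟨r, -, hr⟩ := (IsCyclotomicExtension.zeta_spec p ℚ
    (CyclotomicField p ℚ)).exists_pow_or_neg_mul_pow_of_isOfFinOrder
      (hpp.odd_of_ne_two (by omega)) hfin
  have hr' : cyclotomicChar p (r : ZMod p) =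
      IsCyclotomicExtension.zeta p ℚ (CyclotomicField p ℚ) ^ r := AddChar.zmodChar_apply' _ _
  rw [← hr'] at hr
  refine ⟨r, hr.resolve_right fun h => ?_⟩
  rw [h, map_neg, hσ, neg_mul_neg, mul_neg, ← AddChar.map_add_eq_mul, ← AddChar.map_add_eq_mul,
    show (r + r + -2 * r : ZMod p) = 0 by ring, AddChar.map_zero_eq_one] at hu
  norm_num at hu

end Cyclotomic

section Reconstruction

variable {p : ℕ} [Fact p.Prime] {ι : Type*} {a b : ι → ZMod p → ℚ}

theorem fourierSum_zero_eq
    (h1 : ∀ (i : Fin 1 → ι) (κ : Fin 1 → ZMod p),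
      ∑ g, ∏ s, a (i s) (κ s + g) = ∑ g, ∏ s, b (i s) (κ s + g)) (i : ι) :
    fourierSum (cyclotomicChar p) 0 (a i) = fourierSum (cyclotomicChar p) 0 (b i) := by
  simpa using prod_fourierSum_eq (cyclotomicChar p) _ _ (h1 fun _ => i) 0 (by simp)

theorem fourierSum_mul_eq
    (h2 : ∀ (i : Fin 2 → ι) (κ : Fin 2 → ZMod p),
      ∑ g, ∏ s, a (i s) (κ s + g) = ∑ g, ∏ s, b (i s) (κ s + g)) (i j : ι) :
    fourierSum (cyclotomicChar p) 1 (a i) * fourierSum (cyclotomicChar p) (-1) (a j) =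
      fourierSum (cyclotomicChar p) 1 (b i) * fourierSum (cyclotomicChar p) (-1) (b j) := by
  simpa [Fin.prod_univ_two] using
    prod_fourierSum_eq (cyclotomicChar p) _ _ (h2 ![i, j]) ![1, -1] (by simp)

theorem fourierSum_mul_mul_eq
    (h3 : ∀ (i : Fin 3 → ι) (κ : Fin 3 → ZMod p),
      ∑ g, ∏ s, a (i s) (κ s + g) = ∑ g, ∏ s, b (i s) (κ s + g)) (i : ι) :
    fourierSum (cyclotomicChar p) 1 (a i) * fourierSum (cyclotomicChar p) 1 (a i) *
        fourierSum (cyclotomicChar p) (-2) (a i) =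
      fourierSum (cyclotomicChar p) 1 (b i) * fourierSum (cyclotomicChar p) 1 (b i) *
        fourierSum (cyclotomicChar p) (-2) (b i) := by
  simpa [Fin.prod_univ_three] using
    prod_fourierSum_eq (cyclotomicChar p) _ _ (h3 fun _ => i) ![1, 1, -2]
      (by simp [Fin.sum_univ_three]; ring)

/-- If the Fourier coefficients at frequency `1` differ by a common `p`-th root of unity and the
means agree, then the functions differ by a common shift. -/
theorem exists_shift_of_fourierSum
    (h1 : ∀ (i : Fin 1 → ι) (κ : Fin 1 → ZMod p),
      ∑ g, ∏ s, a (i s) (κ s + g) = ∑ g, ∏ s, b (i s) (κ s + g)) {r : ZMod p}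
    (h : ∀ i, fourierSum (cyclotomicChar p) 1 (b i) =
      cyclotomicChar p r * fourierSum (cyclotomicChar p) 1 (a i)) (i : ι) (k : ZMod p) :
    b i k = a i (k - r) := by
  suffices b i = fun k => a i (k + -r) by rw [this, sub_eq_add_neg]
  refine eq_of_fourierSum_eq isPrimitive_cyclotomicChar fun t => ?_
  rw [fourierSum_shift]
  by_cases ht : t = 0
  · simp [ht, fourierSum_zero_eq h1]
  · obtain ⟨σ, hσ⟩ := exists_algEquiv_cyclotomicChar ht
    rw [← map_fourierSum hσ, h, map_mul, hσ, map_fourierSum hσ, mul_neg, neg_neg]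

/-- If the second moments agree and one nonzero Fourier coefficient changes by a `p`-th root of
unity, then all Fourier coefficients change by that root of unity. -/
theorem fourierSum_eq_of_fourierSum_eq
    (h2 : ∀ (i : Fin 2 → ι) (κ : Fin 2 → ZMod p),
      ∑ g, ∏ s, a (i s) (κ s + g) = ∑ g, ∏ s, b (i s) (κ s + g)) {i₀ : ι} {r : ZMod p}
    (h0 : fourierSum (cyclotomicChar p) 1 (a i₀) ≠ 0)
    (h : fourierSum (cyclotomicChar p) 1 (b i₀) =
      cyclotomicChar p r * fourierSum (cyclotomicChar p) 1 (a i₀)) (i : ι) :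
    fourierSum (cyclotomicChar p) 1 (b i) =
      cyclotomicChar p r * fourierSum (cyclotomicChar p) 1 (a i) := by
  obtain ⟨σ, hσ⟩ := exists_algEquiv_cyclotomicChar (p := p) (neg_ne_zero.2 one_ne_zero)
  have key := fourierSum_mul_eq h2 i i₀
  rw [← map_fourierSum hσ, ← map_fourierSum hσ, h, map_mul, hσ] at key
  have hσ0 : σ (fourierSum (cyclotomicChar p) 1 (a i₀)) ≠ 0 := by simpa using h0
  have hr : cyclotomicChar p r * cyclotomicChar p (-1 * r) = 1 := by
    rw [← AddChar.map_add_eq_mul, neg_one_mul, add_neg_cancel, AddChar.map_zero_eq_one]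
  apply mul_right_cancel₀ hσ0
  linear_combination -cyclotomicChar p r * key -
    fourierSum (cyclotomicChar p) 1 (b i) * σ (fourierSum (cyclotomicChar p) 1 (a i₀)) * hr

theorem exists_shift_of_moments_three (hp : 3 ≤ p)
    (h : ∀ m ≤ 3, ∀ (i : Fin m → ι) (κ : Fin m → ZMod p),
      ∑ g, ∏ s, a (i s) (κ s + g) = ∑ g, ∏ s, b (i s) (κ s + g)) :
    ∃ r, ∀ i k, b i k = a i (k - r) := by
  have h20 : (-2 : ZMod p) ≠ 0 := by
    have : Fact (2 < p) := ⟨hp⟩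
    intro h
    apply ZMod.neg_one_ne_one (n := p)
    linear_combination h
  obtain ⟨σ, hσ⟩ := exists_algEquiv_cyclotomicChar h20
  have key := fourierSum_mul_mul_eq (h 3 le_rfl)
  simp only [← map_fourierSum hσ] at key
  by_cases h0 : ∀ i, fourierSum (cyclotomicChar p) 1 (a i) = 0
  · refine ⟨0, exists_shift_of_fourierSum (h 1 (by norm_num)) fun i => ?_⟩
    simpa [h0] using (key i).symm
  · push Not at h0
    obtain ⟨i₀, h0⟩ := h0
    have hσ0 : σ (fourierSum (cyclotomicChar p) 1 (a i₀)) ≠ 0 := by simpa using h0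
    obtain ⟨r, hr⟩ := exists_eq_cyclotomicChar hp hσ
      (u := fourierSum (cyclotomicChar p) 1 (b i₀) / fourierSum (cyclotomicChar p) 1 (a i₀)) (by
        rw [map_div₀]
        field_simp
        linear_combination -key i₀)
    rw [div_eq_iff h0] at hr
    exact ⟨r, exists_shift_of_fourierSum (h 1 (by norm_num))
      (fourierSum_eq_of_fourierSum_eq (h 2 (by norm_num)) h0 hr)⟩

theorem exists_shift_of_moments_two {a b : ι → ZMod 2 → ℚ}
    (h : ∀ m ≤ 2, ∀ (i : Fin m → ι) (κ : Fin m → ZMod 2),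
      ∑ g, ∏ s, a (i s) (κ s + g) = ∑ g, ∏ s, b (i s) (κ s + g)) :
    ∃ r, ∀ i k, b i k = a i (k - r) := by
  have key := fun i => fourierSum_mul_eq (h 2 le_rfl) i i
  simp only [show (-1 : ZMod 2) = 1 from rfl] at key
  by_cases h0 : ∀ i, fourierSum (cyclotomicChar 2) 1 (a i) = 0
  · refine ⟨0, exists_shift_of_fourierSum (h 1 (by norm_num)) fun i => ?_⟩
    simpa [h0] using (key i).symm
  · push Not at h0
    obtain ⟨i₀, h0⟩ := h0
    have hchar : cyclotomicChar 2 1 = -1 := by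
      have : cyclotomicChar 2 1 = IsCyclotomicExtension.zeta 2 ℚ (CyclotomicField 2 ℚ) ^ 1 := rfl
      rw [this, pow_one]
      exact (IsCyclotomicExtension.zeta_spec 2 ℚ _).eq_neg_one_of_two_right
    obtain ⟨r, hr⟩ : ∃ r, fourierSum (cyclotomicChar 2) 1 (b i₀) =
        cyclotomicChar 2 r * fourierSum (cyclotomicChar 2) 1 (a i₀) := by
      rcases mul_self_eq_mul_self_iff.1 (key i₀) with h | h
      · exact ⟨0, by simp [h]⟩
      · exact ⟨1, by simp [hchar, h]⟩
    exact ⟨r, exists_shift_of_fourierSum (h 1 (by norm_num))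
      (fourierSum_eq_of_fourierSum_eq (h 2 (by norm_num)) h0 hr)⟩

end Reconstruction

/-- If moments up to degree `d` determine families of functions on `ZMod p` up to a shift, then
the invariants of degree at most `d` separate the orbits of any representation. -/
theorem sepByDeg_of_exists_shift {p n d : ℕ} [NeZero p]
    (H : ∀ a b : Fin n → ZMod p → ℚ,
      (∀ m ≤ d, ∀ (i : Fin m → Fin n) (κ : Fin m → ZMod p),
        ∑ g, ∏ s, a (i s) (κ s + g) = ∑ g, ∏ s, b (i s) (κ s + g)) →
      ∃ r, ∀ i k, b i k = a i (k - r))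
    (ρ : Multiplicative (ZMod p) →* Matrix (Fin n) (Fin n) ℚ) : SepByDeg p n d ρ := by
  intro v w hvw
  by_contra! hf
  obtain ⟨r, hr⟩ := H (orbitCoord ρ v) (orbitCoord ρ w)
    fun m hm i κ => sum_prod_orbitCoord_eq hf hm i κ
  refine hvw ⟨Multiplicative.ofAdd (-r), funext fun i => ?_⟩
  simpa [orbitCoord] using (hr i 0).symm

/-- The separating Noether number of `C_p` over `ℚ` is `3` for any prime `p ≥ 3`,
and is `2` for `p = 2`. -/
theorem sepNoetherNumber_Q_cyclic_prime (p : ℕ) (hp : p.Prime) :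
    (3 ≤ p →
      ((∀ (n : ℕ) (ρ : Multiplicative (ZMod p) →* Matrix (Fin n) (Fin n) ℚ)
          (hρ : ∀ g, IsUnit (ρ g)), SepByDeg p n 3 ρ) ∧
        ¬ (∀ (n : ℕ) (ρ : Multiplicative (ZMod p) →* Matrix (Fin n) (Fin n) ℚ)
          (hρ : ∀ g, IsUnit (ρ g)), SepByDeg p n 2 ρ))) ∧
    (p = 2 →
      ((∀ (n : ℕ) (ρ : Multiplicative (ZMod p) →* Matrix (Fin n) (Fin n) ℚ)
          (hρ : ∀ g, IsUnit (ρ g)), SepByDeg p n 2 ρ) ∧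
        ¬ (∀ (n : ℕ) (ρ : Multiplicative (ZMod p) →* Matrix (Fin n) (Fin n) ℚ)
          (hρ : ∀ g, IsUnit (ρ g)), SepByDeg p n 1 ρ))) := by
  have : Fact p.Prime := ⟨hp⟩
  refine ⟨fun h3 => ⟨fun n ρ _ => ?_, fun H => ?_⟩, fun h2 => ?_⟩
  · exact sepByDeg_of_exists_shift (fun _ _ => exists_shift_of_moments_three h3) ρ
  · exact not_sepByDeg_two h3 (H p (regularRep p) isUnit_regularRep)
  · subst h2
    refine ⟨fun n ρ _ => ?_, fun H => ?_⟩
    · exact sepByDeg_of_exists_shift (fun _ _ => exists_shift_of_moments_two) ρ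
    · exact not_sepByDeg_one (H 2 (regularRep 2) isUnit_regularRep)
end

section
/- With notation as in the classification of irreducible representations of a finite abelian group G over a field F with char F ∤ |G|: each representation (F^{ℓ_χ}, ρ_χ) is irreducible over F, the regular representation of G on F(G,F) decomposes as ⊕_{χ ∈ Ĝ/Γ} (F^{ℓ_χ}, ρ_χ) over a set of representatives of the Γ-orbits on Ĝ, and {(F^{ℓ_χ}, ρ_χ) : χ ∈ Ĝ/Γ} is a complete irredundant list of irreducible F-representations of G up to isomorphism. -/
open Polynomial

/-- The companion matrix of a (monic) polynomial `q`. -/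
def companionMatrix {F : Type*} [Field F] (q : Polynomial F) :
    Matrix (Fin q.natDegree) (Fin q.natDegree) F :=
  Matrix.of fun i j =>
    (if (i : ℕ) = (j : ℕ) + 1 then 1 else 0) -
      (if (j : ℕ) = q.natDegree - 1 then q.coeff i else 0)

/-- The action of the Galois group on characters : `(γ · χ)(g) = γ(χ(g))`. -/
def galChar {F K G : Type*} [Field F] [Field K] [Algebra F K] [Group G]
    (γ : K ≃ₐ[F] K) (χ : G →* Kˣ) : G →* Kˣ :=
  (Units.map (γ : K →* K)).comp χ

/-- The data of the irreducible representation `ρ_χ` of `G` over `F` attached to a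
character `χ : G → Kˣ`: an element `gsel` with `χ(gsel)` generating `χ(G)`, and the
representation lifting `gsel^j ker χ ↦ A_χ^j`, where `A_χ` is the companion matrix of
the minimal polynomial over `F` of `χ(gsel)`. -/
structure IrredRepData (F K : Type*) [Field F] [Field K] [Algebra F K]
    (G : Type*) [CommGroup G] where
  χ : G →* Kˣ
  gsel : G
  hgen : ∀ g : G, ∃ n : ℤ, χ g = χ gsel ^ n
  ρ : G →* Matrix (Fin (minpoly F ((χ gsel : Kˣ) : K)).natDegree)
        (Fin (minpoly F ((χ gsel : Kˣ) : K)).natDegree) F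
  hρA : ρ gsel = companionMatrix (minpoly F ((χ gsel : Kˣ) : K))
  hρker : ∀ g ∈ χ.ker, ρ g = 1

/-- The dimension `ℓ_χ` of the representation attached to `χ`. -/
noncomputable def dimOf {F K G : Type*} [Field F] [Field K] [Algebra F K] [CommGroup G]
    (D : IrredRepData F K G) : ℕ :=
  (minpoly F ((D.χ D.gsel : Kˣ) : K)).natDegree

/-- Multiplication by a root `a` of a monic polynomial `q` is given by the companion matrix of `q`
in the coordinates `1, a, a ^ 2, …`. -/
theorem sum_companionMatrix_mulVec_smul_pow {F K : Type*} [Field F] [Field K] [Algebra F K]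
    {q : F[X]} (hq : q.Monic) {a : K} (ha : aeval a q = 0) (v : Fin q.natDegree → F) :
    ∑ i, (companionMatrix q).mulVec v i • a ^ (i : ℕ) = a * ∑ i, v i • a ^ (i : ℕ) := by
  have hcol (j : Fin q.natDegree) :
      ∑ i, companionMatrix q i j • a ^ (i : ℕ) = a ^ ((j : ℕ) + 1) := by
    simp only [companionMatrix, Matrix.of_apply, sub_smul, Finset.sum_sub_distrib, ite_smul,
      one_smul, zero_smul]
    have hj := j.isLt
    by_cases h : (j : ℕ) = q.natDegree - 1
    · have hlast : (j : ℕ) + 1 = q.natDegree := by omega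
      have hroot := ha
      rw [aeval_eq_sum_range, Finset.sum_range_succ, hq.coeff_natDegree, one_smul,
        Finset.sum_range] at hroot
      rw [Finset.sum_eq_zero fun i _ => if_neg (by have := i.isLt; omega), hlast]
      simp only [if_pos h]
      linear_combination -hroot
    · have hlt : (j : ℕ) + 1 < q.natDegree := by omega
      simp only [if_neg h, Finset.sum_const_zero, sub_zero]
      rw [Finset.sum_eq_single ⟨(j : ℕ) + 1, hlt⟩]
      · simp
      · intro i _ hi
        exact if_neg fun h' => hi (Fin.ext h')
      · simp
  simp only [Matrix.mulVec, dotProduct, Finset.sum_smul]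
  rw [Finset.sum_comm, Finset.mul_sum]
  refine Finset.sum_congr rfl fun j _ => ?_
  rw [mul_smul_comm, ← pow_succ', ← hcol j, Finset.smul_sum]
  refine Finset.sum_congr rfl fun i _ => ?_
  rw [smul_smul, mul_comm]

/-- An intertwiner between an endomorphism and multiplication by `a` intertwines polynomials in
them. -/
theorem map_aeval_apply_of_map_apply {F K V : Type*} [Field F] [Field K] [Algebra F K]
    [AddCommGroup V] [Module F V] (φ : V →ₗ[F] K) (T : Module.End F V) (a : K)
    (h : ∀ v, φ (T v) = a * φ v) (p : F[X]) (v : V) :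
    φ (aeval T p v) = aeval a p * φ v := by
  induction p using Polynomial.induction_on' with
  | add p q hp hq => simp [hp, hq, add_mul]
  | monomial n c =>
    have hpow (n : ℕ) : φ ((T ^ n) v) = a ^ n * φ v := by
      induction n with
      | zero => simp
      | succ n ih => rw [pow_succ', Module.End.mul_apply, h, ih, pow_succ', mul_assoc]
    rw [aeval_monomial, aeval_monomial, Module.End.mul_apply, Module.algebraMap_end_apply, map_smul,
      hpow, mul_assoc, Algebra.smul_def]

namespace IrredRepData

variable {F K G : Type*} [Field F] [Field K] [Algebra F K] [CommGroup G]

/-- The linear map `F ^ ℓ_χ → K` sending the standard basis to the powers of `χ(gsel)`. -/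
noncomputable def toField (D : IrredRepData F K G) : (Fin (dimOf D) → F) →ₗ[F] K :=
  Fintype.linearCombination F fun i : Fin (dimOf D) => ((D.χ D.gsel : Kˣ) : K) ^ (i : ℕ)

theorem toField_injective (D : IrredRepData F K G) : Function.Injective D.toField :=
  (linearIndependent_pow ((D.χ D.gsel : Kˣ) : K)).fintypeLinearCombination_injective

theorem toField_eq_zero (D : IrredRepData F K G) {v : Fin (dimOf D) → F} :
    D.toField v = 0 ↔ v = 0 :=
  map_eq_zero_iff _ D.toField_injective

theorem toField_mem_adjoin (D : IrredRepData F K G) (v : Fin (dimOf D) → F) :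
    D.toField v ∈ IntermediateField.adjoin F {((D.χ D.gsel : Kˣ) : K)} := by
  rw [toField, Fintype.linearCombination_apply]
  exact sum_mem fun i _ => IntermediateField.smul_mem _
    (pow_mem (IntermediateField.mem_adjoin_simple_self F _) _)

/-- `ρ_χ` as a representation of `G` on `F ^ ℓ_χ`. -/
noncomputable def rep (D : IrredRepData F K G) : Representation F G (Fin (dimOf D) → F) :=
  (Matrix.toLinAlgEquiv' (R := F)
    (n := Fin (minpoly F ((D.χ D.gsel : Kˣ) : K)).natDegree)).toAlgHom.toMonoidHom.comp D.ρ

theorem rep_apply (D : IrredRepData F K G) (g : G) (v : Fin (dimOf D) → F) :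
    D.rep g v = (D.ρ g).mulVec v :=
  rfl

theorem rep_eq_one (D : IrredRepData F K G) {g : G} (hg : D.χ g = 1) : D.rep g = 1 := by
  refine LinearMap.ext fun v => ?_
  rw [rep_apply, D.hρker g hg]
  exact Matrix.one_mulVec v

variable [Algebra.IsIntegral F K]

theorem dimOf_pos (D : IrredRepData F K G) : 0 < dimOf D :=
  minpoly.natDegree_pos (Algebra.IsIntegral.isIntegral _)

theorem exists_toField_eq_one (D : IrredRepData F K G) : ∃ v, D.toField v = 1 :=
  ⟨Pi.single ⟨0, D.dimOf_pos⟩ 1, by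
    classical
    rw [toField, Fintype.linearCombination_apply_single]
    simp⟩

/-- `toField` intertwines `ρ_χ` with multiplication by `χ`. -/
theorem toField_rep (D : IrredRepData F K G) (g : G) (v : Fin (dimOf D) → F) :
    D.toField (D.rep g v) = ((D.χ g : Kˣ) : K) * D.toField v := by
  let H : Subgroup G :=
    { carrier := {g | ∀ v : Fin (dimOf D) → F,
        D.toField (D.rep g v) = ((D.χ g : Kˣ) : K) * D.toField v}
      one_mem' := fun v => by simp
      mul_mem' := fun {a b} ha hb v => by
        rw [map_mul, Module.End.mul_apply, ha, hb, map_mul, Units.val_mul, mul_assoc]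
      inv_mem' := fun {a} ha v => by
        have h := ha (D.rep a⁻¹ v)
        rw [← Module.End.mul_apply, ← map_mul, mul_inv_cancel, map_one,
          Module.End.one_apply] at h
        rw [h, map_inv D.χ, Units.inv_mul_cancel_left] }
  have hsel : D.gsel ∈ H := fun v => by
    rw [rep_apply, D.hρA]
    exact sum_companionMatrix_mulVec_smul_pow
      (minpoly.monic (Algebra.IsIntegral.isIntegral _)) (minpoly.aeval _ _) v
  have hker (k : G) (hk : D.χ k = 1) : k ∈ H := fun v => by
    rw [D.rep_eq_one hk, hk]
    simp
  obtain ⟨n, hn⟩ := D.hgen g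
  have hg : g ∈ H := by
    rw [← div_mul_cancel g (D.gsel ^ n)]
    refine H.mul_mem (hker _ ?_) (H.zpow_mem hsel n)
    rw [_root_.map_div, map_zpow, hn, div_self']
  exact hg v

/-- Every nonzero vector is cyclic for `ρ_χ`. -/
theorem exists_aeval_apply_eq (D : IrredRepData F K G) {w : Fin (dimOf D) → F} (hw : w ≠ 0)
    (v : Fin (dimOf D) → F) :
    ∃ p : F[X], aeval (D.rep D.gsel) p w = v := by
  have hw' : D.toField w ≠ 0 := mt D.toField_eq_zero.1 hw
  have hmem := div_mem (D.toField_mem_adjoin v) (D.toField_mem_adjoin w)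
  rw [← IntermediateField.mem_toSubalgebra,
    IntermediateField.adjoin_simple_toSubalgebra_of_isAlgebraic
      (Algebra.IsIntegral.isIntegral _).isAlgebraic,
    Algebra.adjoin_singleton_eq_range_aeval] at hmem
  obtain ⟨p, hp⟩ := hmem
  refine ⟨p, D.toField_injective ?_⟩
  have h := map_aeval_apply_of_map_apply D.toField (D.rep D.gsel) _
    (D.toField_rep D.gsel) p w
  refine h.trans ?_
  replace hp : aeval ((D.χ D.gsel : Kˣ) : K) p = D.toField v / D.toField w := hp
  rw [hp, div_mul_cancel₀ _ hw']

/-- `ρ_χ` is irreducible over `F`. -/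
theorem eq_bot_or_eq_top (D : IrredRepData F K G) (W : Submodule F (Fin (dimOf D) → F))
    (hW : ∀ (g : G), ∀ v ∈ W, D.rep g v ∈ W) : W = ⊥ ∨ W = ⊤ := by
  refine or_iff_not_imp_left.2 fun hne => ?_
  obtain ⟨w, hwW, hw⟩ := W.ne_bot_iff.1 hne
  refine eq_top_iff.2 fun v _ => ?_
  obtain ⟨p, rfl⟩ := D.exists_aeval_apply_eq hw v
  exact aeval_apply_smul_mem_of_le_comap hwW p _ fun u hu => hW D.gsel u hu

/-- If a nonzero linear map `F ^ ℓ_χ → K` intertwines `ρ_χ` with multiplication by `ψ`, then `ψ` is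
a Galois conjugate of `χ`. -/
theorem exists_eq_galChar [Normal F K] (D : IrredRepData F K G) (ψ : G →* Kˣ)
    (Φ : (Fin (dimOf D) → F) →ₗ[F] K) {v : Fin (dimOf D) → F} (hv : Φ v ≠ 0)
    (hΦ : ∀ g v, Φ (D.rep g v) = ((ψ g : Kˣ) : K) * Φ v) :
    ∃ γ : K ≃ₐ[F] K, ψ = galChar γ D.χ := by
  have hker (g : G) (hg : D.χ g = 1) : ψ g = 1 := by
    have h := hΦ g v
    rw [D.rep_eq_one hg, Module.End.one_apply] at h
    exact Units.ext (mul_right_cancel₀ hv (by rw [← h, Units.val_one, one_mul]))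
  have hroot : aeval ((ψ D.gsel : Kˣ) : K) (minpoly F ((D.χ D.gsel : Kˣ) : K)) = 0 := by
    have h := map_aeval_apply_of_map_apply Φ (D.rep D.gsel) _
      (hΦ D.gsel) (minpoly F ((D.χ D.gsel : Kˣ) : K)) v
    have h0 := map_aeval_apply_of_map_apply D.toField (D.rep D.gsel) _
      (D.toField_rep D.gsel) (minpoly F ((D.χ D.gsel : Kˣ) : K)) v
    rw [minpoly.aeval, zero_mul] at h0
    have h1 := D.toField_eq_zero.1 h0
    refine (mul_eq_zero.1 (h.symm.trans ?_)).resolve_right hv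
    exact (congrArg Φ h1).trans (map_zero Φ)
  have hconj : IsConjRoot F ((ψ D.gsel : Kˣ) : K) ((D.χ D.gsel : Kˣ) : K) :=
    (minpoly.eq_of_irreducible_of_monic
      (minpoly.irreducible (Algebra.IsIntegral.isIntegral _)) hroot
      (minpoly.monic (Algebra.IsIntegral.isIntegral _))).symm
  obtain ⟨γ, hγ⟩ := isConjRoot_iff_exists_algEquiv.1 hconj
  have hsel : galChar γ D.χ D.gsel = ψ D.gsel := Units.ext hγ
  refine ⟨γ, MonoidHom.ext fun g => ?_⟩
  obtain ⟨n, hn⟩ := D.hgen g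
  have h1 : ψ (g / D.gsel ^ n) = 1 := hker _ (by rw [_root_.map_div, map_zpow, hn, div_self'])
  rw [_root_.map_div, map_zpow, div_eq_one] at h1
  rw [h1, ← hsel, ← map_zpow]
  exact (congrArg (Units.map (γ : K →* K)) (by rw [hn, map_zpow] : D.χ g = D.χ (D.gsel ^ n))).symm

/-- If the characters of the members of a family lie in distinct Galois orbits, then the dimensions
sum to at most the number of characters. -/
theorem sum_dimOf_le [IsGalois F K] [Finite (G →* Kˣ)] {ι : Type*} [Fintype ι]
    (D : ι → IrredRepData F K G)
    (hD : ∀ i j, ∀ γ δ : K ≃ₐ[F] K, galChar γ (D i).χ = galChar δ (D j).χ → i = j) :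
    ∑ i, dimOf (D i) ≤ Nat.card (G →* Kˣ) := by
  have hcard (i : ι) :
      Nat.card ((minpoly F (((D i).χ (D i).gsel : Kˣ) : K)).rootSet K) = dimOf (D i) := by
    rw [Nat.card_eq_fintype_card]
    exact card_rootSet_eq_natDegree (Algebra.IsSeparable.isSeparable F _)
      (Normal.splits (F := F) (K := K) inferInstance _)
  have hconj (i : ι) (b : (minpoly F (((D i).χ (D i).gsel : Kˣ) : K)).rootSet K) :
      ∃ γ : K ≃ₐ[F] K, γ (((D i).χ (D i).gsel : Kˣ) : K) = b := by
    refine isConjRoot_iff_exists_algEquiv.1 (IsConjRoot.symm ?_)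
    exact (isConjRoot_iff_mem_minpoly_rootSet (Algebra.IsIntegral.isIntegral _)).2 b.2
  choose γ hγ using hconj
  simp_rw [← hcard]
  rw [← Nat.card_sigma]
  refine Nat.card_le_card_of_injective (fun x => galChar (γ x.1 x.2) (D x.1).χ) ?_
  rintro ⟨i, b⟩ ⟨j, c⟩ h
  obtain rfl := hD i j _ _ h
  refine Sigma.ext rfl (heq_of_eq (Subtype.ext ?_))
  rw [← hγ i b, ← hγ i c]
  exact congrArg Units.val (DFunLike.congr_fun h (D i).gsel)

end IrredRepData

/-- A function on a finite abelian group whose Fourier coefficients all vanish is zero. -/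
theorem eq_zero_of_forall_sum_smul_character_eq_zero {F K G : Type*} [Field F] [Field K]
    [Algebra F K] [CommGroup G] [Fintype G] [HasEnoughRootsOfUnity K (Monoid.exponent G)]
    (f : G → F) (hf : ∀ ψ : G →* Kˣ, ∑ g, f g • ((ψ g : Kˣ) : K) = 0) : f = 0 := by
  let ev (g : G) : (G →* Kˣ) →* K := (Units.coeHom K).comp (MonoidHom.eval g)
  have hev : Function.Injective ev := fun g h hgh =>
    (CommGroup.forall_apply_eq_apply_iff G (M := K)).1 fun ψ =>
      Units.ext (DFunLike.congr_fun hgh ψ)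
  have hind := Fintype.linearIndependent_iff.1
    ((linearIndependent_monoidHom (G →* Kˣ) K).comp ev hev)
    (fun g => algebraMap F K (f g)) (by
      ext ψ
      rw [Finset.sum_apply, Pi.zero_apply, ← hf ψ]
      refine Finset.sum_congr rfl fun g _ => ?_
      simp [ev, Algebra.smul_def])
  exact funext fun g => (map_eq_zero _).1 (hind g)

section Representation

variable {F G V : Type*} [Field F] [Group G] [AddCommGroup V] [Module F V]

/-- Schur's lemma for an arbitrary pair of irreducible representations. -/
theorem bijective_of_intertwining {W : Type*} [AddCommGroup W] [Module F W]
    (σ : Representation F G V) (τ : Representation F G W) (θ : V →ₗ[F] W) (hne : θ ≠ 0)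
    (hθ : ∀ g v, θ (σ g v) = τ g (θ v))
    (hσ : ∀ U : Submodule F V, (∀ g, ∀ v ∈ U, σ g v ∈ U) → U = ⊥ ∨ U = ⊤)
    (hτ : ∀ U : Submodule F W, (∀ g, ∀ w ∈ U, τ g w ∈ U) → U = ⊥ ∨ U = ⊤) :
    Function.Bijective θ := by
  constructor
  · refine LinearMap.ker_eq_bot.1 ((hσ _ fun g v hv => ?_).resolve_right
      (mt LinearMap.ker_eq_top.1 hne))
    rw [LinearMap.mem_ker] at hv ⊢
    rw [hθ, hv, map_zero]
  · refine LinearMap.range_eq_top.1 ((hτ _ ?_).resolve_left (mt LinearMap.range_eq_bot.1 hne))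
    rintro g _ ⟨v, rfl⟩
    exact ⟨σ g v, hθ g v⟩

variable [Fintype G]

/-- The linear map `F(G, F) → V` sending `f` to `∑ g, f g • σ g v`. -/
noncomputable def orbitMap (σ : Representation F G V) (v : V) : (G → F) →ₗ[F] V :=
  Fintype.linearCombination F fun g => σ g v

theorem orbitMap_translate (σ : Representation F G V) (v : V) (g : G) (f : G → F) :
    orbitMap σ v (fun h => f (g⁻¹ * h)) = σ g (orbitMap σ v f) := by
  simp only [orbitMap, Fintype.linearCombination_apply, map_sum, map_smul]
  refine Fintype.sum_equiv (Equiv.mulLeft g⁻¹) _ _ fun h => ?_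
  rw [Equiv.coe_mulLeft, ← Module.End.mul_apply, ← map_mul, mul_inv_cancel_left]

theorem exists_orbitMap_eq (σ : Representation F G V) (v : V) : ∃ f, orbitMap σ v f = v := by
  classical
  exact ⟨Pi.single 1 1, by simp [orbitMap, Fintype.linearCombination_apply_single]⟩

/-- If the regular representation is a direct sum of irreducible representations, then every
irreducible representation is isomorphic to one of the summands. -/
theorem exists_equiv_of_regular_equiv {ι : Type*} [Finite ι] {W : ι → Type*}
    [∀ i, AddCommGroup (W i)] [∀ i, Module F (W i)] (τ : ∀ i, Representation F G (W i))
    (e : (G → F) ≃ₗ[F] (∀ i, W i))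
    (he : ∀ (g : G) (f : G → F) (i : ι), e (fun h => f (g⁻¹ * h)) i = τ i g (e f i))
    (hτ : ∀ i, ∀ U : Submodule F (W i), (∀ g, ∀ w ∈ U, τ i g w ∈ U) → U = ⊥ ∨ U = ⊤)
    [Nontrivial V] (σ : Representation F G V)
    (hσ : ∀ U : Submodule F V, (∀ g, ∀ v ∈ U, σ g v ∈ U) → U = ⊥ ∨ U = ⊤) :
    ∃ i, ∃ E : V ≃ₗ[F] W i, ∀ g x, E (σ g x) = τ i g (E x) := by
  classical
  obtain ⟨v, hv⟩ := exists_ne (0 : V)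
  let T := orbitMap σ v ∘ₗ e.symm.toLinearMap
  have hT (g : G) (x : ∀ i, W i) : T (fun i => τ i g (x i)) = σ g (T x) := by
    obtain ⟨f, rfl⟩ := e.surjective x
    have h : (fun i => τ i g (e f i)) = e fun h => f (g⁻¹ * h) :=
      funext fun i => (he g f i).symm
    simp only [T, h, LinearMap.comp_apply, LinearEquiv.coe_coe, LinearEquiv.symm_apply_apply,
      orbitMap_translate]
  obtain ⟨i, hi⟩ : ∃ i, T ∘ₗ LinearMap.single F W i ≠ 0 := by
    by_contra! h
    have hT0 : T = 0 := LinearMap.pi_ext' fun i => (h i).trans (LinearMap.zero_comp _).symm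
    obtain ⟨f, hf⟩ := exists_orbitMap_eq σ v
    refine hv ?_
    have := LinearMap.congr_fun hT0 (e f)
    simpa [T, hf] using this
  have hθ (g : G) (x : W i) :
      (T ∘ₗ LinearMap.single F W i) (τ i g x) = σ g ((T ∘ₗ LinearMap.single F W i) x) := by
    refine Eq.trans (congrArg T (funext fun j => ?_)) (hT g (LinearMap.single F W i x))
    exact (Pi.apply_single (fun j => τ j g) (fun j => map_zero _) i x j).symm
  let E := LinearEquiv.ofBijective _ (bijective_of_intertwining (τ i) σ _ hi hθ (hτ i) hσ)
  refine ⟨i, E.symm, fun g x => ?_⟩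
  rw [LinearEquiv.symm_apply_eq]
  obtain ⟨y, rfl⟩ := E.surjective x
  rw [LinearEquiv.symm_apply_apply]
  exact (hθ g y).symm

end Representation

/-- An extension generated by a primitive root of unity is Galois. -/
theorem isGalois_of_adjoin_primitiveRoot_eq_top {F K : Type*} [Field F] [Field K] [Algebra F K]
    {ω : K} {n : ℕ} (hn : n ≠ 0) (hω : IsPrimitiveRoot ω n)
    (hK : IntermediateField.adjoin F {ω} = ⊤) : IsGalois F K := by
  have hint : IsIntegral F ω := hω.isIntegral (Nat.pos_of_ne_zero hn) |>.tower_top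
  have hadj : Algebra.adjoin F {ω} = ⊤ := by
    rw [← IntermediateField.adjoin_simple_toSubalgebra_of_isAlgebraic hint.isAlgebraic, hK,
      IntermediateField.top_toSubalgebra]
  have : IsCyclotomicExtension {n} F K := by
    refine (IsCyclotomicExtension.iff_adjoin_eq_top {n} F K).2 ⟨?_, ?_⟩
    · rintro m rfl -
      exact ⟨ω, hω⟩
    · refine top_le_iff.1 (hadj.symm.trans_le (Algebra.adjoin_mono ?_))
      rintro _ rfl
      exact ⟨n, rfl, hn, hω.pow_eq_one⟩
  exact IsCyclotomicExtension.isGalois {n} F K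

/-- The regular representation is the direct sum of the `ρ_χ`, over a family of data whose
characters represent every Galois orbit exactly once. -/
theorem exists_regular_equiv {F K G ι : Type*} [Field F] [Field K] [Algebra F K] [IsGalois F K]
    [CommGroup G] [Fintype G] [HasEnoughRootsOfUnity K (Monoid.exponent G)] [Fintype ι]
    (D : ι → IrredRepData F K G)
    (hD : ∀ i j, ∀ γ δ : K ≃ₐ[F] K, galChar γ (D i).χ = galChar δ (D j).χ → i = j)
    (hD' : ∀ ψ : G →* Kˣ, ∃ i, ∃ γ : K ≃ₐ[F] K, ψ = galChar γ (D i).χ) :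
    ∃ e : (G → F) ≃ₗ[F] (∀ i, Fin (dimOf (D i)) → F),
      ∀ (g : G) (f : G → F) (i : ι), e (fun h => f (g⁻¹ * h)) i = (D i).rep g (e f i) := by
  have : Finite (G →* Kˣ) :=
    .of_equiv _ (CommGroup.monoidHom_mulEquiv_of_hasEnoughRootsOfUnity G K).some.toEquiv.symm
  choose v hv using fun i => (D i).exists_toField_eq_one
  let T : (G → F) →ₗ[F] (∀ i, Fin (dimOf (D i)) → F) :=
    LinearMap.pi fun i => orbitMap (D i).rep (v i)
  have hT (f : G → F) (i : ι) :
      (D i).toField (T f i) = ∑ g, f g • (((D i).χ g : Kˣ) : K) := by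
    simp [T, orbitMap, Fintype.linearCombination_apply, (D i).toField_rep, hv]
  have hinj : Function.Injective T := by
    refine (injective_iff_map_eq_zero T).2 fun f hf =>
      eq_zero_of_forall_sum_smul_character_eq_zero (K := K) f fun ψ => ?_
    obtain ⟨i, γ, rfl⟩ := hD' ψ
    have h := congrArg γ (hT f i)
    rw [hf, Pi.zero_apply, map_zero, map_zero, map_sum] at h
    rw [h]
    refine Finset.sum_congr rfl fun g _ => ?_
    rw [map_smul]
    rfl
  have hle := IrredRepData.sum_dimOf_le D hD
  rw [CommGroup.card_monoidHom_of_hasEnoughRootsOfUnity, Nat.card_eq_fintype_card] at hle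
  have hdim : Module.finrank F (G → F) = Module.finrank F (∀ i, Fin (dimOf (D i)) → F) := by
    refine (LinearMap.finrank_le_finrank_of_injective hinj).antisymm ?_
    simpa [Module.finrank_pi_fintype] using hle
  exact ⟨LinearEquiv.ofInjectiveOfFinrankEq T hinj hdim, fun g f i =>
    orbitMap_translate (D i).rep (v i) g f⟩

/-- Classification of the irreducible representations of a finite abelian group over a
(non-closed) field `F` with `char F ∤ |G|`, where `K = F(ω)`, `ord(ω) = exp(G)`,
`Γ = Gal(K/F)`: (i) each `ρ_χ` is irreducible over `F`; (ii) the regular representation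
decomposes as `⊕_{χ ∈ Ĝ/Γ} ρ_χ`; (iii) the `ρ_χ`, for `χ` running over a set of
representatives of the `Γ`-orbits of characters, form a complete irredundant list of the
irreducible `F`-representations of `G`. -/
theorem classification_irreducible_reps_abelian_nonclosed
    {G : Type*} [CommGroup G] [Fintype G]
    {F K : Type*} [Field F] [Field K] [Algebra F K]
    (hchar : (Fintype.card G : F) ≠ 0)
    (ω : K) (hω : orderOf ω = Monoid.exponent G)
    (hK : IntermediateField.adjoin F {ω} = ⊤)
    (R : Finset (G →* Kˣ))
    (hR : ∀ ψ : G →* Kˣ, ∃! χ : G →* Kˣ, χ ∈ R ∧ ∃ γ : K ≃ₐ[F] K, ψ = galChar γ χ)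
    (D : {χ : G →* Kˣ // χ ∈ R} → IrredRepData F K G)
    (hD : ∀ r, (D r).χ = (r : G →* Kˣ)) :
    -- (i) each `ρ_χ` is irreducible
    (∀ r, ∀ W : Submodule F (Fin (dimOf (D r)) → F),
      (∀ (g : G), ∀ v ∈ W, ((D r).ρ g).mulVec v ∈ W) → W = ⊥ ∨ W = ⊤) ∧
    -- (ii) the regular representation is the direct sum of the `ρ_χ`
    (∃ e : (G → F) ≃ₗ[F] (∀ r : {χ : G →* Kˣ // χ ∈ R}, Fin (dimOf (D r)) → F),
      ∀ (g : G) (f : G → F) (r : {χ : G →* Kˣ // χ ∈ R}),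
        e (fun h => f (g⁻¹ * h)) r = ((D r).ρ g).mulVec (e f r)) ∧
    -- (iii) completeness and irredundancy of the list
    (∀ (V : Type) (_ : AddCommGroup V) (_ : Module F V) (_ : FiniteDimensional F V)
        (σ : Representation F G V), Nontrivial V →
      (∀ W : Submodule F V, (∀ (g : G), ∀ x ∈ W, σ g x ∈ W) → W = ⊥ ∨ W = ⊤) →
      ∃! r : {χ : G →* Kˣ // χ ∈ R},
        Nonempty {e : V ≃ₗ[F] (Fin (dimOf (D r)) → F) //
          ∀ (g : G) (x : V), e (σ g x) = ((D r).ρ g).mulVec (e x)}) := by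
  have hωp : IsPrimitiveRoot ω (Monoid.exponent G) := hω ▸ IsPrimitiveRoot.orderOf ω
  have hexp : Monoid.exponent G ≠ 0 := Monoid.exponent_ne_zero_of_finite
  have : NeZero (Monoid.exponent G) := ⟨hexp⟩
  have : IsGalois F K := isGalois_of_adjoin_primitiveRoot_eq_top hexp hωp hK
  have : HasEnoughRootsOfUnity K (Monoid.exponent G) := ⟨⟨ω, hωp⟩, inferInstance⟩
  have huniq (i j) (γ : K ≃ₐ[F] K) (h : (D j).χ = galChar γ (D i).χ) : i = j := by
    rw [hD, hD] at h
    exact Subtype.ext ((hR j).unique ⟨i.2, γ, h⟩ ⟨j.2, 1, rfl⟩)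
  obtain ⟨e, he⟩ := exists_regular_equiv D
    (fun i j γ δ h => huniq i j (γ.trans δ.symm) (MonoidHom.ext fun g => Units.ext
      (δ.injective (by
        have hg := congrArg Units.val (DFunLike.congr_fun h g)
        simpa [galChar] using hg.symm))))
    (fun ψ => by
      obtain ⟨χ, ⟨hχ, γ, hγ⟩, -⟩ := hR ψ
      exact ⟨⟨χ, hχ⟩, γ, by rw [hD, hγ]⟩)
  refine ⟨fun r => (D r).eq_bot_or_eq_top, ⟨e, he⟩, fun V _ _ _ σ _ hσ => ?_⟩
  refine existsUnique_of_exists_of_unique ?_ ?_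
  · obtain ⟨r, E, hE⟩ := exists_equiv_of_regular_equiv (fun r => (D r).rep) e he
      (fun r => (D r).eq_bot_or_eq_top) σ hσ
    exact ⟨r, ⟨E, hE⟩⟩
  · rintro i j ⟨E₁, h₁⟩ ⟨E₂, h₂⟩
    obtain ⟨v, hv⟩ := exists_ne (0 : V)
    have hΦ : ((D j).toField ∘ₗ E₂.toLinearMap ∘ₗ E₁.symm.toLinearMap) (E₁ v) ≠ 0 := by
      simpa [(D j).toField_eq_zero] using hv
    obtain ⟨γ, hγ⟩ := (D i).exists_eq_galChar (D j).χ _ hΦ fun g x => by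
      obtain ⟨y, rfl⟩ := E₁.surjective x
      rw [IrredRepData.rep_apply, ← h₁]
      simp only [LinearMap.comp_apply, LinearEquiv.coe_coe, LinearEquiv.symm_apply_apply, h₂]
      exact (D j).toField_rep g _
    exact huniq i j γ hγ
end
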